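/- (Theorem 1.3, version for y and q.) For every γ > 1 and all positive constants Z_U, M₁, M₂, M₃, M₄ there exists a constant N > 0, depending only on γ, Z_U, M₁, M₂, M₃, M₄, with the following property: there is no C² solution (u,z,m) of the system on all of [0,∞) × ℝ that satisfies 0 < z < Z_U, M₁ < m < M₂, |m_x| < M₃ and |m_xx| < M₄ everywhere, has z bounded away from 0 (i.e. z > Z_L for some Z_L > 0), and for which y(0,x*) < −N or q(0,x*) < −N at some point x* ∈ ℝ. Equivalently, for any globally defined smooth solution with these bounds, the initial data satisfy y(0,x) ≥ −N and q(0,x) ≥ −N for all x; if initially y or q is less than −N somewhere, then |u_x| and/or |τ_x| blow up in finite time. -/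

import Mathlib

open Real

/-- Partial derivative with respect to `t` (the first coordinate). -/
noncomputable def pdt (f : ℝ × ℝ → ℝ) (pt : ℝ × ℝ) : ℝ := fderiv ℝ f pt (1, 0)

/-- Partial derivative with respect to `x` (the second coordinate). -/
noncomputable def pdx (f : ℝ × ℝ → ℝ) (pt : ℝ × ℝ) : ℝ := fderiv ℝ f pt (0, 1)

open Set Metric Topology

/-- A function that is at most `-N` initially and satisfies `y' ≤ -ε y²` below the level `-N`
cannot exist on a time interval of length `1 / (ε N)`. -/
lemma riccati_blowup {y y' : ℝ → ℝ} {N ε : ℝ} (hN : 0 < N) (hε : 0 < ε)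
    (hy : ∀ t ∈ Icc 0 (1 / (ε * N)), HasDerivWithinAt y (y' t) (Icc 0 (1 / (ε * N))) t)
    (hy' : ∀ t ∈ Icc 0 (1 / (ε * N)), y t ≤ -N → y' t ≤ -ε * y t ^ 2)
    (h0 : y 0 < -N) : False := by
  set T := 1 / (ε * N) with hT
  have hTpos : 0 < T := by positivity
  have hcont : ContinuousOn y (Icc 0 T) := fun t ht => (hy t ht).continuousWithinAt
  have hle : ∀ ⦃t⦄, t ∈ Icc 0 T → y t ≤ -N := by
    refine image_le_of_deriv_right_lt_deriv_boundary (f' := y') (B' := fun _ => 0) hcont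
      (fun t ht => (hy t (Ico_subset_Icc_self ht)).mono_of_mem_nhdsWithin
        (Icc_mem_nhdsGE_of_mem ht)) h0.le (fun t => hasDerivAt_const t (-N)) ?_
    intro t ht heq
    have := hy' t (Ico_subset_Icc_self ht) heq.le
    have h2 : 0 < ε * y t ^ 2 := by rw [heq, neg_sq]; positivity
    linarith
  have hne : ∀ t ∈ Icc 0 T, y t ≠ 0 := fun t ht h => by linarith [hle ht]
  have hmono : MonotoneOn (fun t => (y t)⁻¹ - ε * t) (Icc 0 T) := by
    have hderiv : ∀ t ∈ interior (Icc 0 T),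
        HasDerivAt (fun t => (y t)⁻¹ - ε * t) (-y' t / y t ^ 2 - ε) t := by
      intro t ht
      have ht' := interior_subset ht
      have hd := (hy t ht').hasDerivAt (mem_interior_iff_mem_nhds.1 ht)
      refine ((hd.inv (hne t ht')).sub ((hasDerivAt_id t).const_mul ε)).congr_deriv ?_
      simp
    refine monotoneOn_of_deriv_nonneg (convex_Icc 0 T)
      ((hcont.inv₀ hne).sub (by fun_prop))
      (fun t ht => (hderiv t ht).differentiableAt.differentiableWithinAt) ?_
    intro t ht
    have ht' := interior_subset ht
    rw [(hderiv t ht).deriv, sub_nonneg, le_div_iff₀ (by have := hne t ht'; positivity)]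
    linarith [hy' t ht' (hle ht')]
  have h1 := hmono (left_mem_Icc.2 hTpos.le) (right_mem_Icc.2 hTpos.le) hTpos.le
  have h2 : (y T)⁻¹ < 0 := inv_lt_zero.2 (by linarith [hle (right_mem_Icc.2 hTpos.le)])
  have h3 : -N⁻¹ < (y 0)⁻¹ := by
    rw [← inv_neg]
    exact (inv_lt_inv_of_neg (by linarith) (by linarith)).2 h0
  have h4 : ε * T = N⁻¹ := by rw [hT]; field_simp
  simp only [mul_zero, sub_zero] at h1
  linarith

lemma riccati_rhs_le {κ κ₀ A A₀ B B₀ ρ y : ℝ} (hB : 0 < B) (hBB : B ≤ B₀) (hρ : 0 < ρ)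
    (hA₀ : 0 ≤ A₀) (hA : A ≤ A₀) (hy : 2 * A₀ * B₀ ^ 2 / ρ ≤ y ^ 2) (hκ₀ : 0 < κ₀)
    (hκ : κ₀ ≤ κ) :
    κ * (B * A - ρ * y ^ 2 / B) ≤ -(κ₀ * ρ / (2 * B₀)) * y ^ 2 := by
  have hκ0 : 0 < κ := hκ₀.trans_le hκ
  have hBA : B * A₀ ≤ ρ * y ^ 2 / (2 * B) := by
    rw [div_le_iff₀ hρ] at hy
    rw [le_div_iff₀ (by positivity)]
    have h1 : A₀ * B ^ 2 ≤ A₀ * B₀ ^ 2 := by gcongr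
    linarith
  calc κ * (B * A - ρ * y ^ 2 / B) ≤ κ * (B * A₀ - ρ * y ^ 2 / B) := by gcongr
    _ ≤ κ * (ρ * y ^ 2 / (2 * B) - ρ * y ^ 2 / B) := by gcongr
    _ = -(κ * ρ / (2 * B)) * y ^ 2 := by
        field_simp
        ring
    _ ≤ -(κ₀ * ρ / (2 * B₀)) * y ^ 2 := by gcongr

/-- Integral curves of a bounded `C¹` vector field on `[0,∞) × ℝ` exist for arbitrarily long
times. -/
lemma exists_characteristic {V : ℝ × ℝ → ℝ} {L : ℝ} (hL : 0 ≤ L)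
    (hV : ∀ pt : ℝ × ℝ, 0 ≤ pt.1 → ContDiffAt ℝ 1 V pt)
    (hVL : ∀ pt : ℝ × ℝ, 0 ≤ pt.1 → |V pt| ≤ L) {T : ℝ} (hT : 0 ≤ T) (x₀ : ℝ) :
    ∃ X : ℝ → ℝ, X 0 = x₀ ∧ ∀ t ∈ Icc 0 T, HasDerivWithinAt X (V (t, X t)) (Icc 0 T) t := by
  have hcompact : IsCompact (Icc 0 T ×ˢ closedBall x₀ (L * T)) :=
    isCompact_Icc.prod (isCompact_closedBall _ _)
  have hcont : ContinuousOn (fderiv ℝ V) (Icc 0 T ×ˢ closedBall x₀ (L * T)) := fun pt hpt =>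
    ((hV pt hpt.1.1).fderiv_right (m := 0) (by norm_num)).continuousAt.continuousWithinAt
  obtain ⟨C, hC⟩ := hcompact.exists_bound_of_continuousOn hcont
  have hPL : IsPicardLindelof (fun t x => V (t, x)) (⟨0, left_mem_Icc.2 hT⟩ : Icc 0 T) x₀
      (L * T).toNNReal 0 L.toNNReal C.toNNReal := by
    have ha : ((L * T).toNNReal : ℝ) = L * T := Real.coe_toNNReal _ (by positivity)
    refine ⟨?_, ?_, ?_, ?_⟩
    · intro t ht
      have hLip : LipschitzOnWith C.toNNReal V (Icc 0 T ×ˢ closedBall x₀ (L * T)) := by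
        refine Convex.lipschitzOnWith_of_nnnorm_hasFDerivWithin_le (f' := fderiv ℝ V)
          (fun pt hpt => ((hV pt hpt.1.1).differentiableAt
            (by norm_num)).hasFDerivAt.hasFDerivWithinAt) ?_
          ((convex_Icc 0 T).prod (convex_closedBall _ _))
        intro pt hpt
        rw [← NNReal.coe_le_coe, coe_nnnorm]
        exact (hC pt hpt).trans (Real.le_coe_toNNReal C)
      have hslice : LipschitzOnWith 1 (fun x : ℝ => (t, x)) (closedBall x₀ (L * T)) :=
        (LipschitzWith.prodMk_left t).lipschitzOnWith
      rw [ha]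
      have hcomp := hLip.comp hslice (fun x hx => ⟨ht, hx⟩)
      rwa [mul_one] at hcomp
    · intro x _ t ht
      exact ((hV (t, x) ht.1).continuousAt.comp
        (f := fun t : ℝ => (t, x)) (by fun_prop)).continuousWithinAt
    · intro t ht x _
      rw [Real.coe_toNNReal _ hL]
      exact hVL (t, x) ht.1
    · rw [ha, Real.coe_toNNReal _ hL]
      simp [hT]
  exact hPL.exists_eq_forall_mem_Icc_hasDerivWithinAt₀

lemma ContDiffAt.differentiableAt_pdx {f : ℝ × ℝ → ℝ} {pt : ℝ × ℝ} (hf : ContDiffAt ℝ 2 f pt) :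
    DifferentiableAt ℝ (pdx f) pt :=
  ((hf.fderiv_right (m := 1) (by norm_num)).differentiableAt (by norm_num)).clm_apply
    (differentiableAt_const _)

lemma ContDiffAt.differentiableAt_pdt {f : ℝ × ℝ → ℝ} {pt : ℝ × ℝ} (hf : ContDiffAt ℝ 2 f pt) :
    DifferentiableAt ℝ (pdt f) pt :=
  ((hf.fderiv_right (m := 1) (by norm_num)).differentiableAt (by norm_num)).clm_apply
    (differentiableAt_const _)

lemma ContDiffAt.pdt_pdx {f : ℝ × ℝ → ℝ} {pt : ℝ × ℝ} (hf : ContDiffAt ℝ 2 f pt) :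
    pdt (pdx f) pt = pdx (pdt f) pt := by
  have hd : DifferentiableAt ℝ (fderiv ℝ f) pt :=
    (hf.fderiv_right (m := 1) (by norm_num)).differentiableAt (by norm_num)
  have key : ∀ v w : ℝ × ℝ, fderiv ℝ (fun q => fderiv ℝ f q v) pt w =
      fderiv ℝ (fderiv ℝ f) pt w v := by
    intro v w
    simp [fderiv_clm_apply hd (differentiableAt_const v)]
  unfold pdt pdx
  rw [key, key]
  exact hf.isSymmSndFDerivAt (by simp) _ _

lemma DifferentiableAt.hasDerivAt_pdx {f : ℝ × ℝ → ℝ} {t x : ℝ}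
    (hf : DifferentiableAt ℝ f (t, x)) :
    HasDerivAt (fun ξ => f (t, ξ)) (pdx f (t, x)) x :=
  hf.hasFDerivAt.comp_hasDerivAt x ((hasDerivAt_const x t).prodMk (hasDerivAt_id x))

lemma DifferentiableAt.hasDerivWithinAt_along {f : ℝ × ℝ → ℝ} {X : ℝ → ℝ} {v t : ℝ} {S : Set ℝ}
    (hf : DifferentiableAt ℝ f (t, X t)) (hX : HasDerivWithinAt X v S t) :
    HasDerivWithinAt (fun τ => f (τ, X τ)) (pdt f (t, X t) + v * pdx f (t, X t)) S t := by
  have h := HasFDerivAt.comp_hasDerivWithinAt (f := fun τ => (τ, X τ)) t hf.hasFDerivAt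
    ((hasDerivWithinAt_id t S).prodMk hX)
  refine h.congr_deriv ?_
  have : ((1, v) : ℝ × ℝ) = (1, 0) + v • (0, 1) := by simp
  rw [this, map_add, map_smul]
  rfl

/-- Classical solutions of the Euler system on `[0,∞) × ℝ` in the variables `(u, z, m)`,
with the sound speed and the pressure written out. -/
structure IsEulerSolution (γ Kc : ℝ) (u z m : ℝ × ℝ → ℝ) : Prop where
  contDiffAt_u : ∀ pt : ℝ × ℝ, 0 ≤ pt.1 → ContDiffAt ℝ 2 u pt
  contDiffAt_z : ∀ pt : ℝ × ℝ, 0 ≤ pt.1 → ContDiffAt ℝ 2 z pt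
  contDiffAt_m : ∀ pt : ℝ × ℝ, 0 ≤ pt.1 → ContDiffAt ℝ 2 m pt
  z_pos : ∀ pt : ℝ × ℝ, 0 ≤ pt.1 → 0 < z pt
  m_pos : ∀ pt : ℝ × ℝ, 0 ≤ pt.1 → 0 < m pt
  pdt_z : ∀ pt : ℝ × ℝ, 0 ≤ pt.1 → pdt z pt = -(Kc * z pt ^ ((γ + 1) / (γ - 1)) * pdx u pt)
  pdt_u : ∀ pt : ℝ × ℝ, 0 ≤ pt.1 → pdt u pt = -(Kc * z pt ^ ((γ + 1) / (γ - 1)) *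
    (m pt * (m pt * pdx z pt + (γ - 1) / γ * (z pt * pdx m pt))))
  pdt_m : ∀ pt : ℝ × ℝ, 0 ≤ pt.1 → pdt m pt = 0

/-- The weighted gradient variable: `y` for `s = 1` and `q` for `s = -1`. -/
noncomputable def gradientVariable (γ s : ℝ) (u z m : ℝ × ℝ → ℝ) (pt : ℝ × ℝ) : ℝ :=
  m pt ^ (-(3 * (3 - γ)) / (2 * (3 * γ - 1))) * (z pt ^ ((γ + 1) / (2 * (γ - 1))) *
    (pdx u pt + s * (m pt * pdx z pt) +
      s * (3 * (γ - 1) / (3 * γ - 1)) * (z pt * pdx m pt)))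

namespace IsEulerSolution

variable {γ Kc s : ℝ} {u z m : ℝ × ℝ → ℝ}

lemma pdt_pdx_z (h : IsEulerSolution γ Kc u z m) {t x : ℝ} (ht : 0 ≤ t) :
    pdt (pdx z) (t, x) = -(Kc * z (t, x) ^ ((γ + 1) / (γ - 1)) *
      (pdx (pdx u) (t, x) + (γ + 1) / (γ - 1) * pdx z (t, x) * pdx u (t, x) / z (t, x))) := by
  have hz := h.contDiffAt_z (t, x) ht
  have hz0 := h.z_pos (t, x) ht
  rw [hz.pdt_pdx]
  have h1 := hz.differentiableAt_pdt.hasDerivAt_pdx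
  simp_rw [fun ξ => h.pdt_z (t, ξ) ht] at h1
  have h2 := (((((hz.differentiableAt (by norm_num)).hasDerivAt_pdx).rpow_const
    (p := (γ + 1) / (γ - 1)) (Or.inl hz0.ne')).const_mul Kc).mul
    (h.contDiffAt_u (t, x) ht).differentiableAt_pdx.hasDerivAt_pdx).neg
  rw [h1.unique h2, rpow_sub_one hz0.ne']
  field_simp
  ring

lemma pdt_pdx_m (h : IsEulerSolution γ Kc u z m) {t x : ℝ} (ht : 0 ≤ t) :
    pdt (pdx m) (t, x) = 0 := by
  have hm := h.contDiffAt_m (t, x) ht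
  rw [hm.pdt_pdx]
  have h1 := hm.differentiableAt_pdt.hasDerivAt_pdx
  simp_rw [fun ξ => h.pdt_m (t, ξ) ht] at h1
  exact h1.unique (hasDerivAt_const x 0)

lemma pdt_pdx_u (h : IsEulerSolution γ Kc u z m) {t x : ℝ} (ht : 0 ≤ t) :
    pdt (pdx u) (t, x) = -(Kc * z (t, x) ^ ((γ + 1) / (γ - 1)) *
      ((γ + 1) / (γ - 1) * pdx z (t, x) / z (t, x) * (m (t, x) * (m (t, x) * pdx z (t, x) +
          (γ - 1) / γ * (z (t, x) * pdx m (t, x)))) +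
        pdx m (t, x) * (m (t, x) * pdx z (t, x) + (γ - 1) / γ * (z (t, x) * pdx m (t, x))) +
        m (t, x) * (pdx m (t, x) * pdx z (t, x) + m (t, x) * pdx (pdx z) (t, x) +
          (γ - 1) / γ * (pdx z (t, x) * pdx m (t, x) + z (t, x) * pdx (pdx m) (t, x))))) := by
  have hu := h.contDiffAt_u (t, x) ht
  have hz := h.contDiffAt_z (t, x) ht
  have hm := h.contDiffAt_m (t, x) ht
  have hz0 := h.z_pos (t, x) ht
  rw [hu.pdt_pdx]
  have h1 := hu.differentiableAt_pdt.hasDerivAt_pdx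
  simp_rw [fun ξ => h.pdt_u (t, ξ) ht] at h1
  have dz := (hz.differentiableAt (by norm_num)).hasDerivAt_pdx
  have dm := (hm.differentiableAt (by norm_num)).hasDerivAt_pdx
  have h2 := (((dz.rpow_const (p := (γ + 1) / (γ - 1)) (Or.inl hz0.ne')).const_mul Kc).mul
    (dm.mul ((dm.mul hz.differentiableAt_pdx.hasDerivAt_pdx).add
      ((dz.mul hm.differentiableAt_pdx.hasDerivAt_pdx).const_mul ((γ - 1) / γ))))).neg
  rw [h1.unique h2, rpow_sub_one hz0.ne']
  simp only [Pi.mul_apply, Pi.add_apply]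
  ring

/-- The Riccati equation for the gradient variables along characteristics. -/
lemma hasDerivWithinAt_gradientVariable (h : IsEulerSolution γ Kc u z m) (hγ : 1 < γ)
    (hs : s ^ 2 = 1) {X : ℝ → ℝ} {t : ℝ} {S : Set ℝ} (ht : 0 ≤ t)
    (hX : HasDerivWithinAt X
      (s * (Kc * m (t, X t) * z (t, X t) ^ ((γ + 1) / (γ - 1)))) S t) :
    HasDerivWithinAt (fun τ => gradientVariable γ s u z m (τ, X τ))
      (Kc * z (t, X t) ^ ((γ + 1) / (γ - 1)) *
        (m (t, X t) ^ (-(3 * (3 - γ)) / (2 * (3 * γ - 1))) *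
            z (t, X t) ^ ((γ + 1) / (2 * (γ - 1))) * z (t, X t) *
            ((γ - 1) / (γ * (3 * γ - 1)) * m (t, X t) * pdx (pdx m) (t, X t) -
              (γ - 1) * (3 * γ + 1) / (γ * (3 * γ - 1) ^ 2) * pdx m (t, X t) ^ 2) -
          (γ + 1) / (2 * (γ - 1)) * gradientVariable γ s u z m (t, X t) ^ 2 /
            (m (t, X t) ^ (-(3 * (3 - γ)) / (2 * (3 * γ - 1))) *
              z (t, X t) ^ ((γ + 1) / (2 * (γ - 1))) * z (t, X t)))) S t := by
  have hu := h.contDiffAt_u (t, X t) ht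
  have hz := h.contDiffAt_z (t, X t) ht
  have hm := h.contDiffAt_m (t, X t) ht
  have hz0 := h.z_pos (t, X t) ht
  have hm0 := h.m_pos (t, X t) ht
  have dz := (hz.differentiableAt (by norm_num)).hasDerivWithinAt_along hX
  have dm := (hm.differentiableAt (by norm_num)).hasDerivWithinAt_along hX
  have dzx := hz.differentiableAt_pdx.hasDerivWithinAt_along hX
  have dmx := hm.differentiableAt_pdx.hasDerivWithinAt_along hX
  have dux := hu.differentiableAt_pdx.hasDerivWithinAt_along hX
  rw [h.pdt_pdx_z ht] at dzx
  rw [h.pdt_pdx_m ht] at dmx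
  rw [h.pdt_pdx_u ht] at dux
  rw [h.pdt_z _ ht] at dz
  rw [h.pdt_m _ ht] at dm
  have hd := (dm.rpow_const (p := -(3 * (3 - γ)) / (2 * (3 * γ - 1))) (Or.inl hm0.ne')).mul
    ((dz.rpow_const (p := (γ + 1) / (2 * (γ - 1))) (Or.inl hz0.ne')).mul
      ((dux.add ((dm.mul dzx).const_mul s)).add
        ((dz.mul dmx).const_mul (s * (3 * (γ - 1) / (3 * γ - 1))))))
  refine hd.congr_deriv ?_
  rw [rpow_sub_one hz0.ne', rpow_sub_one hm0.ne']
  have hP := rpow_pos_of_pos hm0 (-(3 * (3 - γ)) / (2 * (3 * γ - 1)))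
  have hZ := rpow_pos_of_pos hz0 ((γ + 1) / (2 * (γ - 1)))
  simp only [gradientVariable, Pi.mul_apply, Pi.add_apply]
  generalize m (t, X t) ^ (-(3 * (3 - γ)) / (2 * (3 * γ - 1))) = P at *
  generalize z (t, X t) ^ ((γ + 1) / (2 * (γ - 1))) = Z at *
  generalize z (t, X t) ^ ((γ + 1) / (γ - 1)) = κ at *
  generalize z (t, X t) = z₀ at *
  generalize m (t, X t) = m₀ at *
  generalize pdx z (t, X t) = zx
  generalize pdx m (t, X t) = mx
  generalize pdx u (t, X t) = ux
  generalize pdx (pdx z) (t, X t) = zxx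
  generalize pdx (pdx m) (t, X t) = mxx
  generalize pdx (pdx u) (t, X t) = uxx
  have g1 : γ - 1 ≠ 0 := by linarith
  have g2 : 3 * γ - 1 ≠ 0 := by linarith
  have g3 : γ ≠ 0 := by linarith
  have hZ' := hZ.ne'
  have hP' := hP.ne'
  have hz' := hz0.ne'
  have hm' := hm0.ne'
  field_simp
  ring_nf
  simp only [hs]
  ring

/-- The gradient variables of a global solution are initially bounded below, with a bound that
does not depend on the solution, on `Kc` or on the lower bound of `z`. -/
lemma exists_neg_le_gradientVariable (γ : ℝ) (hγ : 1 < γ) {ZU M1 M2 M4 : ℝ} (hZU : 0 < ZU)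
    (hM1 : 0 < M1) (hM2 : 0 < M2) (hM4 : 0 < M4) :
    ∃ N : ℝ, 0 < N ∧ ∀ (Kc ZL : ℝ) (u z m : ℝ × ℝ → ℝ), 0 < Kc → 0 < ZL →
      IsEulerSolution γ Kc u z m →
      (∀ pt : ℝ × ℝ, 0 ≤ pt.1 → ZL < z pt ∧ z pt < ZU ∧ M1 < m pt ∧ m pt < M2 ∧
        |pdx (pdx m) pt| < M4) →
      ∀ s : ℝ, s ^ 2 = 1 → ∀ x : ℝ, -N ≤ gradientVariable γ s u z m (0, x) := by
  have hγ1 : 0 < γ - 1 := by linarith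
  have hγ3 : 0 < 3 * γ - 1 := by linarith
  have hγ0 : 0 < γ := by linarith
  set μ := -(3 * (3 - γ)) / (2 * (3 * γ - 1)) with hμ
  set ρ := (γ + 1) / (2 * (γ - 1)) with hρ
  have hρ0 : 0 < ρ := by positivity
  set A₀ := (γ - 1) / (γ * (3 * γ - 1)) * M2 * M4 with hA₀
  have hA₀0 : 0 < A₀ := by positivity
  set B₀ := (M1 ^ μ + M2 ^ μ) * ZU ^ ρ * ZU with hB₀
  have hB₀0 : 0 < B₀ := by positivity
  set N := 1 + 2 * A₀ * B₀ ^ 2 / ρ with hN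
  have hN0 : 0 < N := by positivity
  have hN1 : 1 ≤ N := by
    rw [hN]
    exact le_add_of_nonneg_right (by positivity)
  refine ⟨N, hN0, ?_⟩
  intro Kc ZL u z m hKc hZL h hb s hs x
  have he : 0 < (γ + 1) / (γ - 1) := by positivity
  set V : ℝ × ℝ → ℝ := fun pt => s * (Kc * m pt * z pt ^ ((γ + 1) / (γ - 1))) with hV
  have hVdiff : ∀ pt : ℝ × ℝ, 0 ≤ pt.1 → ContDiffAt ℝ 1 V pt := fun pt hpt =>
    contDiffAt_const.mul ((contDiffAt_const.mul ((h.contDiffAt_m pt hpt).of_le (by norm_num))).mul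
      (((h.contDiffAt_z pt hpt).of_le (by norm_num)).rpow_const_of_ne (h.z_pos pt hpt).ne'))
  have hs1 : |s| = 1 := (pow_eq_one_iff_of_nonneg (abs_nonneg s) two_ne_zero).1
    (by rw [sq_abs, hs])
  have hVbound : ∀ pt : ℝ × ℝ, 0 ≤ pt.1 → |V pt| ≤ Kc * M2 * ZU ^ ((γ + 1) / (γ - 1)) := by
    intro pt hpt
    obtain ⟨-, hz, -, hm, -⟩ := hb pt hpt
    have hz0 := h.z_pos pt hpt
    have hm0 := h.m_pos pt hpt
    rw [hV, abs_mul, hs1, one_mul, abs_of_pos (by positivity)]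
    gcongr
  by_contra! hlt
  set ε := Kc * ZL ^ ((γ + 1) / (γ - 1)) * ρ / (2 * B₀) with hε
  have hε0 : 0 < ε := by positivity
  obtain ⟨X, hX0, hX⟩ := exists_characteristic (by positivity) hVdiff hVbound
    (T := 1 / (ε * N)) (by positivity) x
  refine riccati_blowup hN0 hε0
    (fun t ht => h.hasDerivWithinAt_gradientVariable hγ hs ht.1 (hX t ht)) ?_ (by rwa [hX0])
  intro t ht hy
  obtain ⟨hzL, hzU, hm1, hm2, hmxx⟩ := hb (t, X t) ht.1
  have hz0 := h.z_pos (t, X t) ht.1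
  have hm0 := h.m_pos (t, X t) ht.1
  set y := gradientVariable γ s u z m (t, X t)
  set B := m (t, X t) ^ μ * z (t, X t) ^ ρ * z (t, X t) with hB
  have hB0 : 0 < B := by positivity
  have hP : m (t, X t) ^ μ ≤ M1 ^ μ + M2 ^ μ := by
    have h1 : 0 < M1 ^ μ := by positivity
    have h2 : 0 < M2 ^ μ := by positivity
    rcases le_total 0 μ with hμ0 | hμ0
    · linarith [rpow_le_rpow hm0.le hm2.le hμ0]
    · linarith [rpow_le_rpow_of_nonpos hM1 hm1.le hμ0]
  have hBB : B ≤ B₀ := by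
    rw [hB, hB₀]
    gcongr
  have hA : (γ - 1) / (γ * (3 * γ - 1)) * m (t, X t) * pdx (pdx m) (t, X t) -
      (γ - 1) * (3 * γ + 1) / (γ * (3 * γ - 1) ^ 2) * pdx m (t, X t) ^ 2 ≤ A₀ := by
    have h1 : (γ - 1) / (γ * (3 * γ - 1)) * m (t, X t) * pdx (pdx m) (t, X t) ≤ A₀ := by
      calc _ ≤ (γ - 1) / (γ * (3 * γ - 1)) * m (t, X t) * M4 := by
            gcongr
            exact (le_abs_self _).trans hmxx.le
        _ ≤ A₀ := by rw [hA₀]; gcongr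
    have h2 : 0 ≤ (γ - 1) * (3 * γ + 1) / (γ * (3 * γ - 1) ^ 2) * pdx m (t, X t) ^ 2 := by
      positivity
    linarith
  have hyN : 2 * A₀ * B₀ ^ 2 / ρ ≤ y ^ 2 := by nlinarith
  have hκ : Kc * ZL ^ ((γ + 1) / (γ - 1)) ≤ Kc * z (t, X t) ^ ((γ + 1) / (γ - 1)) := by gcongr
  exact riccati_rhs_le hB0 hBB hρ0 hA₀0.le hA hyN (by positivity) hκ

end IsEulerSolution

/-- Theorem 1.3 (version for `y` and `q`): there is `N > 0`, depending only on
`γ, Z_U, M₁, M₂, M₃, M₄`, such that every globally defined smooth solution on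
`[0,∞) × ℝ` with the stated bounds satisfies `y(0,x) ≥ −N` and `q(0,x) ≥ −N`
for all `x` (i.e. no such solution has `y` or `q` below `−N` initially). -/
theorem stmt_13 (γ : ℝ) (hγ : 1 < γ)
    (ZU M1 M2 M3 M4 : ℝ) (hZU : 0 < ZU) (hM1 : 0 < M1) (hM2 : 0 < M2)
    (hM3 : 0 < M3) (hM4 : 0 < M4) :
    ∃ N : ℝ, 0 < N ∧
      ∀ (Kc ZL : ℝ), 0 < Kc → 0 < ZL →
      ∀ (W : Set (ℝ × ℝ)), IsOpen W → {pt : ℝ × ℝ | 0 ≤ pt.1} ⊆ W →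
      ∀ u z m c p α β yt qt yf qf : ℝ × ℝ → ℝ,
        ContDiffOn ℝ 2 u W → ContDiffOn ℝ 2 z W → ContDiffOn ℝ 2 m W →
        c = (fun pt => Kc * m pt * z pt ^ ((γ + 1) / (γ - 1))) →
        p = (fun pt => ((γ - 1) / (2 * γ) * Kc) * (m pt) ^ 2 * z pt ^ (2 * γ / (γ - 1))) →
        α = (fun pt => pdx u pt + m pt * pdx z pt + ((γ - 1) / γ) * pdx m pt * z pt) →
        β = (fun pt => pdx u pt - m pt * pdx z pt - ((γ - 1) / γ) * pdx m pt * z pt) →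
        yt = (fun pt => z pt ^ ((γ + 1) / (2 * (γ - 1))) * α pt
          + ((γ - 1) / (γ * (3 * γ - 1))) * z pt ^ ((γ + 1) / (2 * (γ - 1)) + 1) * pdx m pt) →
        qt = (fun pt => z pt ^ ((γ + 1) / (2 * (γ - 1))) * β pt
          - ((γ - 1) / (γ * (3 * γ - 1))) * z pt ^ ((γ + 1) / (2 * (γ - 1)) + 1) * pdx m pt) →
        yf = (fun pt => m pt ^ (-(3 * (3 - γ)) / (2 * (3 * γ - 1))) * yt pt) →
        qf = (fun pt => m pt ^ (-(3 * (3 - γ)) / (2 * (3 * γ - 1))) * qt pt) →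
        (∀ pt : ℝ × ℝ, 0 ≤ pt.1 → pdt z pt + (c pt / m pt) * pdx u pt = 0) →
        (∀ pt : ℝ × ℝ, 0 ≤ pt.1 →
          pdt u pt + m pt * c pt * pdx z pt + 2 * (p pt / m pt) * pdx m pt = 0) →
        (∀ pt : ℝ × ℝ, 0 ≤ pt.1 → pdt m pt = 0) →
        (∀ pt : ℝ × ℝ, 0 ≤ pt.1 → ZL < z pt ∧ z pt < ZU ∧ M1 < m pt ∧ m pt < M2 ∧
          |pdx m pt| < M3 ∧ |pdx (pdx m) pt| < M4) →
        ∀ x : ℝ, -N ≤ yf (0, x) ∧ -N ≤ qf (0, x) := by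
  obtain ⟨N, hN, key⟩ :=
    IsEulerSolution.exists_neg_le_gradientVariable γ hγ hZU hM1 hM2 hM4
  refine ⟨N, hN, ?_⟩
  intro Kc ZL hKc hZL W hW hsub u z m c p α β yt qt yf qf hu hz hm hc hp hα hβ hyt hqt hyf hqf
    hzt hut hmt hb x
  subst hc hp hα hβ hyt hqt hyf hqf
  have hγ0 : γ ≠ 0 := by linarith
  have hγ1 : γ - 1 ≠ 0 := by linarith
  have hγ3 : 3 * γ - 1 ≠ 0 := by linarith
  have hz0 : ∀ pt : ℝ × ℝ, 0 ≤ pt.1 → 0 < z pt := fun pt hpt => hZL.trans (hb pt hpt).1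
  have hm0 : ∀ pt : ℝ × ℝ, 0 ≤ pt.1 → 0 < m pt := fun pt hpt => hM1.trans (hb pt hpt).2.2.1
  have hsol : IsEulerSolution γ Kc u z m := by
    refine ⟨fun pt hpt => hu.contDiffAt (hW.mem_nhds (hsub hpt)),
      fun pt hpt => hz.contDiffAt (hW.mem_nhds (hsub hpt)),
      fun pt hpt => hm.contDiffAt (hW.mem_nhds (hsub hpt)), hz0, hm0, ?_, ?_, hmt⟩
    · intro pt hpt
      have h1 := hzt pt hpt
      have h2 := (hm0 pt hpt).ne'
      field_simp at h1
      linear_combination h1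
    · intro pt hpt
      have h1 := hut pt hpt
      have h2 := (hm0 pt hpt).ne'
      have h3 : 2 * γ / (γ - 1) = (γ + 1) / (γ - 1) + 1 := by
        field_simp
        ring
      simp only [h3, rpow_add_one (hz0 pt hpt).ne'] at h1
      generalize z pt ^ ((γ + 1) / (γ - 1)) = κ at *
      have h4 : 2 * ((γ - 1) / (2 * γ) * Kc * m pt ^ 2 * (κ * z pt) / m pt) =
          (γ - 1) / γ * Kc * m pt * (κ * z pt) := by
        field_simp
      rw [h4] at h1
      linear_combination h1
  have hbound := fun s hs => key Kc ZL u z m hKc hZL hsol (fun pt hpt =>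
    ⟨(hb pt hpt).1, (hb pt hpt).2.1, (hb pt hpt).2.2.1, (hb pt hpt).2.2.2.1,
      (hb pt hpt).2.2.2.2.2⟩) s hs x
  have hx := hz0 (0, x) le_rfl
  constructor
  · refine (hbound 1 (by norm_num)).trans_eq ?_
    simp only [gradientVariable, rpow_add_one hx.ne']
    field_simp
    ring
  · refine (hbound (-1) (by norm_num)).trans_eq ?_
    simp only [gradientVariable, rpow_add_one hx.ne']
    field_simp
    ring
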